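/- Let N ≥ 1, let φ be a symmetric 2-coloring of pairs of distinct natural numbers less than N, and let Q = (v_1 < v_2 < ... < v_m) be a subset of {0,1,...,2^N − 1} that is independent in H, with δ_i = δ(v_i, v_{i+1}). Suppose a_1 < c ≤ b_2 < a_2 are indices in {1,...,m−1} satisfying: δ_{b_2} < δ_{a_1} < δ_{a_2}; δ_y < δ_{a_1} for all a_1 < y ≤ b_2; δ_y < δ_{b_2} for all c ≤ y < b_2; δ_y < δ_{a_2} for all b_2 < y < a_2; and φ(δ_{a_1}, δ_{a_2}) = φ(δ_{b_2}, δ_{a_2}). Then for every index x with c ≤ x < b_2, one has φ(δ_x, δ_{b_2}) ≠ φ(δ_{b_2}, δ_{a_2}). -/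

import Mathlib

/-- For distinct natural numbers `a` and `b`, `delta a b` is the largest index `i`
such that the `i`-th binary digits of `a` and `b` differ (the position of the
highest set bit of `a XOR b`). -/
def delta (a b : ℕ) : ℕ := Nat.log 2 (a ^^^ b)

/-- The edge predicate of the 4-uniform hypergraph `H` determined by a symmetric
2-coloring `φ` of pairs: for `v₁ < v₂ < v₃ < v₄` with `δᵢ = delta vᵢ v_{i+1}`,
`(v₁,v₂,v₃,v₄)` is an edge iff one of the conditions (i), (ii), (iii) holds. -/
def IsEdge (φ : ℕ → ℕ → Bool) (v₁ v₂ v₃ v₄ : ℕ) : Prop :=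
  (((delta v₁ v₂ < delta v₂ v₃ ∧ delta v₂ v₃ < delta v₃ v₄) ∨
    (delta v₂ v₃ < delta v₁ v₂ ∧ delta v₃ v₄ < delta v₂ v₃)) ∧
    φ (delta v₁ v₂) (delta v₂ v₃) = φ (delta v₂ v₃) (delta v₃ v₄) ∧
    φ (delta v₁ v₂) (delta v₂ v₃) ≠ φ (delta v₁ v₂) (delta v₃ v₄)) ∨
  (delta v₂ v₃ < delta v₁ v₂ ∧ delta v₂ v₃ < delta v₃ v₄ ∧
    delta v₃ v₄ < delta v₁ v₂ ∧
    φ (delta v₁ v₂) (delta v₂ v₃) ≠ φ (delta v₂ v₃) (delta v₃ v₄)) ∨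
  (delta v₂ v₃ < delta v₁ v₂ ∧ delta v₂ v₃ < delta v₃ v₄ ∧
    delta v₁ v₂ < delta v₃ v₄ ∧
    φ (delta v₁ v₂) (delta v₂ v₃) = φ (delta v₁ v₂) (delta v₃ v₄) ∧
    φ (delta v₁ v₂) (delta v₃ v₄) = φ (delta v₂ v₃) (delta v₃ v₄))

/-- The `δ`-sequence of an increasing sequence of vertices `v`:
`dseq v i = delta (v i) (v (i+1))`. -/
def dseq (v : ℕ → ℕ) (i : ℕ) : ℕ := delta (v i) (v (i + 1))

theorem log_two_xor_of_lt {p r : ℕ} (h : p < 2 ^ Nat.log 2 r) :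
    Nat.log 2 (p ^^^ r) = Nat.log 2 r := by
  rcases Nat.eq_zero_or_pos r with rfl | hr
  · have hp : p = 0 := by simpa using h
    simp [hp]
  have hup : p ^^^ r < 2 ^ (Nat.log 2 r + 1) :=
    Nat.xor_lt_two_pow (h.trans (Nat.pow_lt_pow_right one_lt_two (Nat.lt_succ_self _)))
      (Nat.lt_pow_succ_log_self one_lt_two r)
  have hlow : 2 ^ Nat.log 2 r ≤ p ^^^ r := by
    by_contra! hlt
    have hlt' : p ^^^ (p ^^^ r) < 2 ^ Nat.log 2 r := Nat.xor_lt_two_pow h hlt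
    rw [Nat.xor_xor_cancel_left] at hlt'
    exact absurd (Nat.pow_log_le_self 2 hr.ne') (not_le.mpr hlt')
  exact Nat.log_eq_of_pow_le_of_lt_pow hlow hup

theorem xor_lt_two_pow_of_dseq_lt {v : ℕ → ℕ} {D i j : ℕ} (hij : i ≤ j)
    (h : ∀ y, i ≤ y → y < j → dseq v y < D) : v i ^^^ v j < 2 ^ D := by
  induction j, hij using Nat.le_induction with
  | base => simp
  | succ j hij ih =>
    have hstep : v j ^^^ v (j + 1) < 2 ^ D :=
      Nat.lt_pow_of_log_lt one_lt_two (h j hij (Nat.lt_succ_self j))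
    have hxor := Nat.xor_lt_two_pow
      (ih fun y hy hyj => h y hy (hyj.trans (Nat.lt_succ_self j))) hstep
    rwa [Nat.xor_assoc, Nat.xor_xor_cancel_left] at hxor

/-- If the `δ`-sequence on `[i, j)` has a strict maximum at `p`, then `delta (v i) (v j)` is
that maximum. -/
theorem delta_eq_dseq_of_strict_max {v : ℕ → ℕ} {i p j : ℕ} (hip : i ≤ p) (hpj : p < j)
    (h : ∀ y, i ≤ y → y < j → y ≠ p → dseq v y < dseq v p) :
    delta (v i) (v j) = dseq v p := by
  have hleft : v i ^^^ v p < 2 ^ dseq v p :=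
    xor_lt_two_pow_of_dseq_lt hip fun y hy hyp => h y hy (by omega) (by omega)
  have hright : v (p + 1) ^^^ v j < 2 ^ dseq v p :=
    xor_lt_two_pow_of_dseq_lt hpj fun y hy hyj => h y (by omega) hyj (by omega)
  have hsplit : v i ^^^ v j =
      ((v i ^^^ v p) ^^^ (v (p + 1) ^^^ v j)) ^^^ (v p ^^^ v (p + 1)) := by
    apply Nat.eq_of_testBit_eq
    intro k
    simp only [Nat.testBit_xor]
    grind
  rw [delta, hsplit]
  exact log_two_xor_of_lt (Nat.xor_lt_two_pow hleft hright)

theorem claim_colour_alternation (N m : ℕ) (hN : 1 ≤ N)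
    (φ : ℕ → ℕ → Bool) (hsym : ∀ a b, φ a b = φ b a)
    (v : ℕ → ℕ) (hv : ∀ i j, i < j → j < m → v i < v j)
    (hvN : ∀ i, i < m → v i < 2 ^ N)
    (hind : ∀ i j k l, i < j → j < k → k < l → l < m →
      ¬ IsEdge φ (v i) (v j) (v k) (v l))
    (a₁ c b₂ a₂ : ℕ)
    (h1 : a₁ < c) (h2 : c ≤ b₂) (h3 : b₂ < a₂) (h4 : a₂ < m - 1)
    (hd1 : dseq v b₂ < dseq v a₁) (hd2 : dseq v a₁ < dseq v a₂)
    (hy1 : ∀ y, a₁ < y → y ≤ b₂ → dseq v y < dseq v a₁)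
    (hy2 : ∀ y, c ≤ y → y < b₂ → dseq v y < dseq v b₂)
    (hy3 : ∀ y, b₂ < y → y < a₂ → dseq v y < dseq v a₂)
    (hcol : φ (dseq v a₁) (dseq v a₂) = φ (dseq v b₂) (dseq v a₂)) :
    ∀ x, c ≤ x → x < b₂ →
      φ (dseq v x) (dseq v b₂) ≠ φ (dseq v b₂) (dseq v a₂) := by
  intro x hcx hxb heq
  have hXB := hy2 x hcx hxb
  have hA : delta (v a₁) (v x) = dseq v a₁ :=
    delta_eq_dseq_of_strict_max le_rfl (by omega) fun y _ _ _ => hy1 y (by omega) (by omega)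
  have hX : delta (v x) (v (x + 1)) = dseq v x := rfl
  have hB : delta (v (x + 1)) (v (b₂ + 1)) = dseq v b₂ :=
    delta_eq_dseq_of_strict_max (by omega) (by omega) fun y _ _ _ => hy2 y (by omega) (by omega)
  have hlt : ∀ y, a₁ < y → y < a₂ → dseq v y < dseq v a₂ := fun y hy hya => by
    rcases le_or_gt y b₂ with hyb | hyb
    · exact (hy1 y hy hyb).trans hd2
    · exact hy3 y hyb hya
  have hC : delta (v (x + 1)) (v (a₂ + 1)) = dseq v a₂ :=
    delta_eq_dseq_of_strict_max (by omega) (by omega) fun y _ _ _ => hlt y (by omega) (by omega)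
  have hC' : delta (v (b₂ + 1)) (v (a₂ + 1)) = dseq v a₂ :=
    delta_eq_dseq_of_strict_max (by omega) (by omega) fun y _ _ _ => hlt y (by omega) (by omega)
  -- The three quadruples have `δ`-patterns `(X, B, C)`, `(A, X, B)` and `(A, X, C)`.
  have hXBC := hind x (x + 1) (b₂ + 1) (a₂ + 1) (by omega) (by omega) (by omega) (by omega)
  have hAXB := hind a₁ x (x + 1) (b₂ + 1) (by omega) (by omega) (by omega) (by omega)
  have hAXC := hind a₁ x (x + 1) (a₂ + 1) (by omega) (by omega) (by omega) (by omega)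
  simp only [IsEdge, hA, hX, hB, hC, hC'] at hXBC hAXB hAXC
  have hφXC : φ (dseq v x) (dseq v b₂) = φ (dseq v x) (dseq v a₂) := by
    by_contra hne
    exact hXBC (.inl ⟨.inl ⟨hXB, hd1.trans hd2⟩, heq, hne⟩)
  have hφAX : φ (dseq v a₁) (dseq v x) = φ (dseq v x) (dseq v b₂) := by
    by_contra hne
    exact hAXB (.inr (.inl ⟨hXB.trans hd1, hXB, hd1, hne⟩))
  have hφAC : φ (dseq v a₁) (dseq v a₂) = φ (dseq v x) (dseq v b₂) := hcol.trans heq.symm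
  exact hAXC (.inr (.inr ⟨hXB.trans hd1, (hXB.trans hd1).trans hd2, hd2,
    hφAX.trans hφAC.symm, hφAC.trans hφXC⟩))
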